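/- arXiv:2303.04013 — 3 statements merged into one kernel-verified Lean document; each statement's English description precedes it below -/
import Mathlib

section
/- Let V be an oriented real inner product space of even dimension n with oriented orthonormal basis e₁, …, eₙ, and let ω_ℂ := i^{n/2} e₁ ⋯ eₙ ∈ Cℓ(V) ⊗ ℂ. Let S be a finite-dimensional complex vector space and φ : Cℓ(V) ⊗_ℝ ℂ → End_ℂ(S) an isomorphism of ℂ-algebras. Then for every a ∈ Cℓ(V) ⊗ ℂ, the supertrace str(a) := tr_ℂ(φ(ω_ℂ · a)) satisfies str(a) = (−2i)^{n/2} · T(s(a)), where s(a) := c(a)(1) is the (complexified) symbol map and T(ω) denotes the coefficient of e₁ ∧ ⋯ ∧ eₙ in ω (the Berezin integral). -/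
open TensorProduct

/-- Left exterior multiplication `ε_v : ω ↦ v ∧ ω` on the exterior algebra `ΛV`. -/
noncomputable def epsilonMul {V : Type*} [NormedAddCommGroup V] [InnerProductSpace ℝ V]
    (v : V) : Module.End ℝ (ExteriorAlgebra ℝ V) :=
  LinearMap.mulLeft ℝ (ExteriorAlgebra.ι ℝ v)

/-- Interior product (left contraction) `ι_v` with the linear functional `⟨v, ·⟩` on `ΛV`. -/
noncomputable def interiorProd {V : Type*} [NormedAddCommGroup V] [InnerProductSpace ℝ V]
    (v : V) : Module.End ℝ (ExteriorAlgebra ℝ V) :=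
  CliffordAlgebra.contractLeft (Q := (0 : QuadraticForm ℝ V)) (innerₗ V v)

/-- The complex volume element `ω_ℂ = i^{n/2} e₁ ⋯ eₙ` in the complexified Clifford algebra,
built from an orthonormal basis `e₁, …, eₙ`. -/
noncomputable def complexVolume {V : Type} [NormedAddCommGroup V] [InnerProductSpace ℝ V]
    {n : ℕ} (Q : QuadraticForm ℝ V) (e : OrthonormalBasis (Fin n) ℝ V) :
    ℂ ⊗[ℝ] CliffordAlgebra Q :=
  Complex.I ^ (n / 2) •
    ((1 : ℂ) ⊗ₜ[ℝ] (List.ofFn fun j : Fin n => CliffordAlgebra.ι Q (e j)).prod)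

section AnticommutingFamily

variable {ι B : Type*} [Ring B] {γ : ι → B}

theorem mul_prod_map_of_notMem (hanti : ∀ i j, i ≠ j → γ i * γ j = -(γ j * γ i))
    {j : ι} {l : List ι} (hj : j ∉ l) :
    γ j * (l.map γ).prod = (-1) ^ l.length * ((l.map γ).prod * γ j) := by
  induction l with
  | nil => simp
  | cons i l ih =>
    rw [List.mem_cons, not_or] at hj
    rw [List.map_cons, List.prod_cons, ← mul_assoc, hanti j i hj.1, neg_mul, mul_assoc, ih hj.2,
      List.length_cons, pow_succ]
    rcases neg_one_pow_eq_or B l.length with h | h <;> rw [h] <;> simp [mul_assoc]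

theorem mul_prod_map_of_mem (hanti : ∀ i j, i ≠ j → γ i * γ j = -(γ j * γ i))
    {j : ι} {l : List ι} (hl : l.Nodup) (hj : j ∈ l) :
    γ j * (l.map γ).prod = -((-1) ^ l.length * ((l.map γ).prod * γ j)) := by
  induction l with
  | nil => simp at hj
  | cons i l ih =>
    rw [List.nodup_cons] at hl
    by_cases hij : j = i
    · subst hij
      rw [List.map_cons, List.prod_cons, List.length_cons, pow_succ]
      nth_rewrite 1 [mul_prod_map_of_notMem hanti hl.1]
      rcases neg_one_pow_eq_or B l.length with h | h <;> rw [h] <;> simp [mul_assoc]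
    · have hj' : j ∈ l := (List.mem_cons.1 hj).resolve_left hij
      rw [List.map_cons, List.prod_cons, ← mul_assoc, hanti j i hij, neg_mul, mul_assoc,
        ih hl.2 hj', List.length_cons, pow_succ]
      rcases neg_one_pow_eq_or B l.length with h | h <;> rw [h] <;> simp [mul_assoc]

theorem prod_map_mul_self (hanti : ∀ i j, i ≠ j → γ i * γ j = -(γ j * γ i))
    (hsq : ∀ i, γ i * γ i = -1) {l : List ι} (hl : l.Nodup) :
    (l.map γ).prod * (l.map γ).prod = (-1) ^ (∑ k ∈ Finset.range (l.length + 1), k) := by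
  induction l with
  | nil => simp
  | cons i l ih =>
    rw [List.nodup_cons] at hl
    have h1 := mul_prod_map_of_notMem hanti hl.1
    have h2 : (l.map γ).prod * γ i = (-1) ^ l.length * (γ i * (l.map γ).prod) := by
      rw [h1, ← mul_assoc, ← pow_add, Even.neg_one_pow ⟨_, rfl⟩, one_mul]
    calc (List.map γ (i :: l)).prod * (List.map γ (i :: l)).prod
        = γ i * ((l.map γ).prod * γ i) * (l.map γ).prod := by simp [mul_assoc]
      _ = (-1) ^ l.length * ((γ i * γ i) * ((l.map γ).prod * (l.map γ).prod)) := by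
        rw [h2]
        rcases neg_one_pow_eq_or B l.length with h | h <;> rw [h] <;> simp [mul_assoc]
      _ = _ := by
        rw [hsq, ih hl.2, List.length_cons, Finset.sum_range_succ _ (l.length + 1), pow_add,
          pow_succ _ l.length]
        rcases neg_one_pow_eq_or B l.length with h | h <;> rw [h] <;> simp

theorem prod_map_mul_of_anticommute {W : B} (hW : ∀ i, γ i * W = -(W * γ i)) (l : List ι) :
    (l.map γ).prod * W = (-1) ^ l.length * (W * (l.map γ).prod) := by
  induction l with
  | nil => simp
  | cons i l ih =>
    rw [List.map_cons, List.prod_cons, mul_assoc, ih, List.length_cons, pow_succ]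
    rcases neg_one_pow_eq_or B l.length with h | h <;> rw [h] <;>
      simp [← mul_assoc, hW]

theorem tracial_mul_prod_map_eq_zero {M : Type*} [AddCommGroup M] [IsAddTorsionFree M]
    (τ : B →+ M) (hτ : ∀ x y, τ (x * y) = τ (y * x))
    (hanti : ∀ i j, i ≠ j → γ i * γ j = -(γ j * γ i)) (hsq : ∀ i, γ i * γ i = -1)
    {W : B} (hW : ∀ i, γ i * W = -(W * γ i)) {j : ι} {l : List ι} (hj : j ∉ l) :
    τ (W * (l.map γ).prod) = 0 := by
  refine self_eq_neg.1 ?_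
  rcases Nat.even_or_odd l.length with h | h
  · have h1 := mul_prod_map_of_notMem hanti hj
    rw [h.neg_one_pow, one_mul] at h1
    calc τ (W * (l.map γ).prod) = τ (-(W * (γ j * γ j)) * (l.map γ).prod) := by rw [hsq]; simp
      _ = τ (γ j * (W * (γ j * (l.map γ).prod))) := by
        rw [← mul_assoc (γ j) W, hW]; simp [mul_assoc]
      _ = τ (W * (l.map γ).prod * (γ j * γ j)) := by rw [hτ, h1]; simp [mul_assoc]
      _ = -τ (W * (l.map γ).prod) := by rw [hsq]; simp
  · nth_rewrite 1 [hτ]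
    rw [prod_map_mul_of_anticommute hW, h.neg_one_pow, neg_one_mul, map_neg]

theorem exists_sorted_mul_prod_map [LinearOrder ι]
    (hanti : ∀ i j, i ≠ j → γ i * γ j = -(γ j * γ i)) (hsq : ∀ i, γ i * γ i = -1)
    (i : ι) {l : List ι} (hl : l.Pairwise (· < ·)) :
    ∃ t : List ι, t.Pairwise (· < ·) ∧ (∀ x ∈ t, x = i ∨ x ∈ l) ∧
      (γ i * (l.map γ).prod = (t.map γ).prod ∨ γ i * (l.map γ).prod = -(t.map γ).prod) := by
  induction l with
  | nil => exact ⟨[i], by simp⟩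
  | cons k l ih =>
    rw [List.pairwise_cons] at hl
    rcases lt_trichotomy i k with h | h | h
    · refine ⟨i :: k :: l, ?_, by simp, Or.inl (by simp)⟩
      simp only [List.pairwise_cons, List.mem_cons]
      refine ⟨?_, hl⟩
      rintro x (rfl | hx)
      exacts [h, h.trans (hl.1 x hx)]
    · subst h
      exact ⟨l, hl.2, by simp +contextual, Or.inr (by simp [← mul_assoc, hsq])⟩
    · obtain ⟨t, ht, hmem, heq⟩ := ih hl.2
      refine ⟨k :: t, List.pairwise_cons.2 ⟨fun x hx => ?_, ht⟩, ?_, ?_⟩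
      · rcases hmem x hx with rfl | hx
        exacts [h, hl.1 x hx]
      · intro x hx
        rcases List.mem_cons.1 hx with rfl | hx
        · simp
        · rcases hmem x hx with rfl | hx <;> simp [*]
      · rw [List.map_cons, List.prod_cons, ← mul_assoc, hanti i k h.ne', neg_mul, mul_assoc]
        rcases heq with heq | heq <;> simp [heq]

end AnticommutingFamily

theorem List.Pairwise.eq_finRange {n : ℕ} {l : List (Fin n)} (hl : l.Pairwise (· < ·))
    (h : ∀ j, j ∈ l) : l = List.finRange n := by
  refine List.Perm.eq_of_pairwise (le := (· < ·)) (fun a b _ _ h1 h2 => (lt_asymm h1 h2).elim)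
    hl (List.pairwise_lt_finRange n) ?_
  rw [List.perm_ext_iff_of_nodup hl.nodup (List.nodup_finRange n)]
  simp [h]

theorem CliffordAlgebra.span_sorted_prod_eq_top {R M ι : Type*} [CommRing R] [AddCommGroup M]
    [Module R M] [LinearOrder ι] {Q : QuadraticForm R M} (b : Module.Basis ι R M)
    (hanti : ∀ i j, i ≠ j → CliffordAlgebra.ι Q (b i) * CliffordAlgebra.ι Q (b j) =
      -(CliffordAlgebra.ι Q (b j) * CliffordAlgebra.ι Q (b i)))
    (hsq : ∀ i, CliffordAlgebra.ι Q (b i) * CliffordAlgebra.ι Q (b i) = -1) :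
    Submodule.span R {x | ∃ l : List ι, l.Pairwise (· < ·) ∧
      (l.map fun i => CliffordAlgebra.ι Q (b i)).prod = x} = ⊤ := by
  rw [eq_top_iff]
  rintro x -
  induction x using CliffordAlgebra.left_induction with
  | algebraMap r =>
    rw [Algebra.algebraMap_eq_smul_one]
    exact Submodule.smul_mem _ _ (Submodule.subset_span ⟨[], by simp⟩)
  | add x y hx hy => exact add_mem hx hy
  | ι_mul x m hx =>
    induction hx using Submodule.span_induction with
    | mem x hx =>
      obtain ⟨l, hl, rfl⟩ := hx
      induction b.mem_span m using Submodule.span_induction with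
      | mem m hm =>
        obtain ⟨i, rfl⟩ := hm
        obtain ⟨t, ht, -, h⟩ := exists_sorted_mul_prod_map hanti hsq i hl
        have := Submodule.subset_span (R := R)
          (s := {x | ∃ l : List ι, l.Pairwise (· < ·) ∧
            (l.map fun i => CliffordAlgebra.ι Q (b i)).prod = x}) ⟨t, ht, rfl⟩
        rcases h with h | h <;> rw [h]
        exacts [this, neg_mem this]
      | zero => simp
      | add x y _ _ hx hy => rw [map_add, add_mul]; exact add_mem hx hy
      | smul r x _ hx => rw [map_smul, smul_mul_assoc]; exact Submodule.smul_mem _ _ hx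
    | zero => simp
    | add x y _ _ hx hy => rw [mul_add]; exact add_mem hx hy
    | smul r x _ hx => rw [mul_smul_comm]; exact Submodule.smul_mem _ _ hx

theorem ExteriorAlgebra.finrank_eq {K V : Type*} [Field K] [AddCommGroup V] [Module K V]
    [FiniteDimensional K V] :
    Module.finrank K (ExteriorAlgebra K V) = 2 ^ Module.finrank K V := by
  rw [Module.finrank_eq_card_basis (Module.Basis.ExteriorAlgebra (Module.finBasis K V))]
  simp

theorem interiorProd_prod_eq_zero {V : Type*} [NormedAddCommGroup V] [InnerProductSpace ℝ V]
    {w : V} {l : List V} (hl : ∀ v ∈ l, inner ℝ w v = 0) :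
    interiorProd w (l.map (ExteriorAlgebra.ι ℝ)).prod = 0 := by
  induction l with
  | nil => exact CliffordAlgebra.contractLeft_one (Q := (0 : QuadraticForm ℝ V)) (innerₗ V w)
  | cons v l ih =>
    have h := CliffordAlgebra.contractLeft_ι_mul (Q := (0 : QuadraticForm ℝ V)) (innerₗ V w) v
      (l.map (ExteriorAlgebra.ι ℝ)).prod
    have ih' := ih fun v hv => hl v (List.mem_cons_of_mem _ hv)
    rw [List.map_cons, List.prod_cons]
    unfold interiorProd at ih' ⊢
    refine h.trans ?_
    rw [ih', innerₗ_apply_apply, hl v List.mem_cons_self]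
    simp

theorem clifford_prod_apply_one {V : Type*} [NormedAddCommGroup V] [InnerProductSpace ℝ V]
    {Q : QuadraticForm ℝ V}
    {c : CliffordAlgebra Q →ₐ[ℝ] Module.End ℝ (ExteriorAlgebra ℝ V)}
    (hc : ∀ v : V, c (CliffordAlgebra.ι Q v) = epsilonMul v - interiorProd v)
    {l : List V} (hl : l.Pairwise fun v w => inner ℝ v w = 0) :
    c (l.map (CliffordAlgebra.ι Q)).prod 1 = (l.map (ExteriorAlgebra.ι ℝ)).prod := by
  induction l with
  | nil => simp
  | cons v l ih =>
    rw [List.pairwise_cons] at hl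
    rw [List.map_cons, List.prod_cons, map_mul, Module.End.mul_apply, ih hl.2, hc,
      LinearMap.sub_apply, interiorProd_prod_eq_zero hl.1, sub_zero]
    simp [epsilonMul]

theorem ExteriorAlgebra.prod_map_ι_mem {R M : Type*} [CommRing R] [AddCommGroup M] [Module R M]
    (l : List M) : (l.map (ExteriorAlgebra.ι R)).prod ∈ ⋀[R]^l.length M := by
  induction l with
  | nil => simp
  | cons v l ih =>
    rw [List.map_cons, List.prod_cons, List.length_cons, exteriorPower, pow_succ']
    exact Submodule.mul_mem_mul ⟨v, rfl⟩ ih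

/-- The supertrace `str(a) := tr(φ(ω_ℂ · a))` on `Cℓ(V) ⊗ ℂ ≅ End(S)` equals
`(−2i)^{n/2}` times the Berezin integral `T` of the symbol `s(a) = c(a)(1)`. -/
theorem supertrace_eq_berezin_of_symbol
    (V : Type) [NormedAddCommGroup V] [InnerProductSpace ℝ V]
    (n : ℕ) (hn : Even n) (hdim : Module.finrank ℝ V = n)
    (o : Orientation ℝ V (Fin n))
    (e : OrthonormalBasis (Fin n) ℝ V) (he : e.toBasis.orientation = o)
    (Q : QuadraticForm ℝ V) (hQ : ∀ v : V, Q v = -‖v‖ ^ 2)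
    -- the Clifford map `c : Cℓ(V) → End(ΛV)`, `c(v) = ε_v − ι_v`
    (c : CliffordAlgebra Q →ₐ[ℝ] Module.End ℝ (ExteriorAlgebra ℝ V))
    (hc : ∀ v : V, c (CliffordAlgebra.ι Q v) = epsilonMul v - interiorProd v)
    -- the complexified symbol map `s(z ⊗ a) = z ⊗ c(a)(1)`
    (s : (ℂ ⊗[ℝ] CliffordAlgebra Q) →ₗ[ℂ] (ℂ ⊗[ℝ] ExteriorAlgebra ℝ V))
    (hs : ∀ (z : ℂ) (a : CliffordAlgebra Q), s (z ⊗ₜ[ℝ] a) = z ⊗ₜ[ℝ] (c a 1))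
    -- the Berezin integral `T`: the coefficient of `e₁ ∧ ⋯ ∧ eₙ` in the top-degree component
    (T : (ℂ ⊗[ℝ] ExteriorAlgebra ℝ V) →ₗ[ℂ] ℂ)
    (hT1 : T ((1 : ℂ) ⊗ₜ[ℝ] (List.ofFn fun j : Fin n => ExteriorAlgebra.ι ℝ (e j)).prod) = 1)
    (hT0 : ∀ k : ℕ, k ≠ n → ∀ x ∈ (⋀[ℝ]^k V : Submodule ℝ (ExteriorAlgebra ℝ V)),
      ∀ z : ℂ, T (z ⊗ₜ[ℝ] x) = 0)
    -- a finite-dimensional complex vector space `S` and a `ℂ`-algebra isomorphism `φ`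
    (S : Type) [AddCommGroup S] [Module ℂ S] [FiniteDimensional ℂ S]
    (φ : (ℂ ⊗[ℝ] CliffordAlgebra Q) ≃ₐ[ℂ] Module.End ℂ S) :
    ∀ a : ℂ ⊗[ℝ] CliffordAlgebra Q,
      LinearMap.trace ℂ S (φ (complexVolume Q e * a))
        = (-2 * Complex.I) ^ (n / 2) * T (s a) := by
  obtain ⟨m, hm⟩ := hn
  have hm2 : n / 2 = m := by omega
  have hfd : FiniteDimensional ℝ V := e.toBasis.finiteDimensional_of_finite
  set γ : Fin n → CliffordAlgebra Q := fun j => CliffordAlgebra.ι Q (e j) with hγ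
  have hsq : ∀ i, γ i * γ i = -1 := fun i => by
    simp [hγ, CliffordAlgebra.ι_sq_scalar, hQ]
  have hanti : ∀ i j, i ≠ j → γ i * γ j = -(γ j * γ i) := fun i j hij => by
    refine CliffordAlgebra.ι_mul_ι_comm_of_isOrtho ?_
    rw [QuadraticMap.isOrtho_def, hQ, hQ, hQ, @norm_add_sq_real, e.orthonormal.2 hij]
    ring
  set W : CliffordAlgebra Q := ((List.finRange n).map γ).prod with hWdef
  have hW : ∀ i, γ i * W = -(W * γ i) := fun i => by
    rw [hWdef, mul_prod_map_of_mem hanti (List.nodup_finRange n) (List.mem_finRange i),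
      List.length_finRange, Even.neg_one_pow ⟨m, hm⟩, one_mul]
  have hWW : W * W = (-1) ^ m := by
    rw [hWdef, prod_map_mul_self hanti hsq (List.nodup_finRange n), List.length_finRange]
    have : ∑ k ∈ Finset.range (n + 1), k = 2 * (m * m) + m := by
      rw [Finset.sum_range_id, hm]
      exact Nat.div_eq_of_eq_mul_left two_pos (by simp; ring)
    rw [this, pow_add, pow_mul]
    simp
  have hdimS : Module.finrank ℂ S = 2 ^ m := by
    have h1 := φ.toLinearEquiv.finrank_eq
    rw [Module.finrank_baseChange, (CliffordAlgebra.equivExterior Q).finrank_eq,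
      ExteriorAlgebra.finrank_eq, hdim, Module.finrank_linearMap, hm, pow_add] at h1
    exact (Nat.mul_self_inj.1 h1).symm
  let τ : CliffordAlgebra Q →ₗ[ℝ] ℂ :=
    ((LinearMap.trace ℂ S ∘ₗ φ.toLinearMap).restrictScalars ℝ) ∘ₗ
      (Algebra.TensorProduct.includeRight : CliffordAlgebra Q →ₐ[ℝ] ℂ ⊗[ℝ] CliffordAlgebra Q
        ).toLinearMap
  have hτ_apply : ∀ x, τ x = LinearMap.trace ℂ S (φ ((1 : ℂ) ⊗ₜ[ℝ] x)) := fun _ => rfl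
  have hτ : ∀ x y, τ (x * y) = τ (y * x) := fun x y => by
    have h : ∀ x y : CliffordAlgebra Q, (1 : ℂ) ⊗ₜ[ℝ] (x * y) = (1 ⊗ₜ[ℝ] x) * (1 ⊗ₜ[ℝ] y) :=
      fun x y => by simp
    rw [hτ_apply, hτ_apply, h, h, map_mul φ, map_mul φ, LinearMap.trace_mul_comm]
  have hτ1 : τ 1 = 2 ^ m := by
    rw [hτ_apply, ← Algebra.TensorProduct.one_def, map_one, LinearMap.trace_one, hdimS]
    simp
  have key : ∀ x : CliffordAlgebra Q,
      Complex.I ^ m * τ (W * x) = (-2 * Complex.I) ^ m * T ((1 : ℂ) ⊗ₜ[ℝ] c x 1) := by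
    intro x
    have hx : x ∈ Submodule.span ℝ {x | ∃ l : List (Fin n), l.Pairwise (· < ·) ∧
        (l.map fun i => CliffordAlgebra.ι Q (e.toBasis i)).prod = x} := by
      rw [CliffordAlgebra.span_sorted_prod_eq_top e.toBasis
        (by simpa only [OrthonormalBasis.coe_toBasis] using hanti)
        (by simpa only [OrthonormalBasis.coe_toBasis] using hsq)]
      trivial
    induction hx using Submodule.span_induction with
    | mem x hx =>
      obtain ⟨l, hl, rfl⟩ := hx
      simp only [OrthonormalBasis.coe_toBasis]
      have hcl : c (l.map γ).prod 1 = (l.map fun j => ExteriorAlgebra.ι ℝ (e j)).prod := by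
        have := clifford_prod_apply_one hc (l := l.map e)
          (List.pairwise_map.2 (hl.imp fun h => e.orthonormal.2 h.ne))
        simpa [List.map_map, Function.comp_def] using this
      change Complex.I ^ m * τ (W * (l.map γ).prod) = _ * T (1 ⊗ₜ[ℝ] (c (l.map γ).prod) 1)
      rw [hcl]
      by_cases hfull : ∀ j, j ∈ l
      · obtain rfl := hl.eq_finRange hfull
        rw [List.ofFn_eq_map] at hT1
        rw [hT1, ← hWdef, hWW]
        have h1 : τ ((-1) ^ m) = (-1) ^ m * 2 ^ m := by
          rcases neg_one_pow_eq_or ℤ m with h | h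
          · have := (neg_one_pow_eq_one_iff_even (by norm_num)).1 h
            rw [this.neg_one_pow, this.neg_one_pow, hτ1, one_mul]
          · have := (neg_one_pow_eq_neg_one_iff_odd (by norm_num)).1 h
            rw [this.neg_one_pow, this.neg_one_pow, map_neg, hτ1, neg_one_mul]
        rw [h1, ← mul_pow, ← mul_pow, mul_one]
        congr 1
        ring
      · push Not at hfull
        obtain ⟨j, hj⟩ := hfull
        have hlen : l.length ≠ n := fun h => hj (by
          have hsub := List.subperm_of_subset hl.nodup (fun x _ => List.mem_finRange x)
          exact (hsub.perm_of_length_le (by simp [h])).mem_iff.2 (List.mem_finRange j))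
        have hmem := ExteriorAlgebra.prod_map_ι_mem (R := ℝ) (l.map e)
        rw [List.length_map, List.map_map] at hmem
        have h0 := tracial_mul_prod_map_eq_zero τ.toAddMonoidHom hτ hanti hsq hW hj
        rw [LinearMap.toAddMonoidHom_coe] at h0
        have hT : T (1 ⊗ₜ[ℝ] (l.map fun j => ExteriorAlgebra.ι ℝ (e j)).prod) = 0 :=
          hT0 _ hlen _ hmem 1
        rw [h0, hT, mul_zero, mul_zero]
    | zero => simp
    | add x y _ _ hx hy =>
      rw [mul_add, map_add, mul_add, hx, hy, map_add, LinearMap.add_apply, TensorProduct.tmul_add,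
        map_add, mul_add]
    | smul r x _ hx =>
      rw [mul_smul_comm, map_smul, mul_smul_comm, hx, map_smul, LinearMap.smul_apply,
        TensorProduct.tmul_smul, LinearMap.map_smul_of_tower, mul_smul_comm]
  have hvol : complexVolume Q e = Complex.I ^ m • ((1 : ℂ) ⊗ₜ[ℝ] W) := by
    rw [complexVolume, hm2, List.ofFn_eq_map]
  intro a
  rw [hm2, hvol]
  induction a using TensorProduct.induction_on with
  | zero => simp
  | add x y hx hy => rw [mul_add, map_add, map_add, hx, hy, map_add, map_add, mul_add]
  | tmul z x =>
    have h1 : (Complex.I ^ m • ((1 : ℂ) ⊗ₜ[ℝ] W)) * (z ⊗ₜ[ℝ] x) =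
        (z * Complex.I ^ m) • ((1 : ℂ) ⊗ₜ[ℝ] (W * x)) := by
      simp [TensorProduct.smul_tmul', mul_comm]
    have h2 : z ⊗ₜ[ℝ] (c x 1) = z • ((1 : ℂ) ⊗ₜ[ℝ] (c x 1)) := by
      simp [TensorProduct.smul_tmul']
    rw [h1, hs, h2, map_smul, map_smul, map_smul, ← hτ_apply, smul_eq_mul, smul_eq_mul, mul_assoc,
      key]
    ring
end

section
/- Let V be a finite-dimensional real inner product space with orthonormal basis e₁, …, eₙ, and let c : Cℓ(V) → End(ΛV) be the algebra homomorphism determined by c(v) = ε_v − ι_v. For every set of indices I = {i₁ < i₂ < ⋯ < i_k}, the family of endomorphisms λ^{k} · U_λ^♯( c(e_{i₁}) ∘ c(e_{i₂}) ∘ ⋯ ∘ c(e_{i_k}) ) converges in End(ΛV) (finite-dimensional, hence with its canonical topology), as λ → 0⁺, to the left exterior multiplication operator ε_{e_{i₁}} ∘ ε_{e_{i₂}} ∘ ⋯ ∘ ε_{e_{i_k}} (ω ↦ e_{i₁} ∧ ⋯ ∧ e_{i_k} ∧ ω). -/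
open Filter Topology

/-- Contraction by a vector lowers the exterior degree by one. -/
theorem interiorProd_mem_exteriorPower {V : Type*} [NormedAddCommGroup V] [InnerProductSpace ℝ V]
    (v : V) (m : ℕ) :
    ∀ x ∈ (⋀[ℝ]^(m + 1) V : Submodule ℝ (ExteriorAlgebra ℝ V)),
      interiorProd v x ∈ (⋀[ℝ]^m V : Submodule ℝ (ExteriorAlgebra ℝ V)) := by
  induction m with
  | zero =>
    intro x hx
    rw [ExteriorAlgebra.exteriorPower, zero_add, pow_one] at hx
    obtain ⟨w, rfl⟩ := hx
    have h : interiorProd v (ExteriorAlgebra.ι ℝ w) = algebraMap ℝ _ (inner ℝ v w) :=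
      CliffordAlgebra.contractLeft_ι (0 : QuadraticForm ℝ V) (innerₗ V v) w
    rw [h, ExteriorAlgebra.exteriorPower, pow_zero]
    exact Submodule.algebraMap_mem _
  | succ m ih =>
    intro x hx
    rw [ExteriorAlgebra.exteriorPower, pow_succ'] at hx
    induction hx using Submodule.mul_induction_on' with
    | mem_mul_mem a ha b hb =>
      obtain ⟨w, rfl⟩ := ha
      have h : interiorProd v (ExteriorAlgebra.ι ℝ w * b)
          = inner ℝ v w • b - ExteriorAlgebra.ι ℝ w * interiorProd v b :=
        CliffordAlgebra.contractLeft_ι_mul (Q := (0 : QuadraticForm ℝ V)) (innerₗ V v) w b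
      rw [h]
      refine Submodule.sub_mem _ (Submodule.smul_mem _ _ hb) ?_
      rw [ExteriorAlgebra.exteriorPower, pow_succ']
      exact Submodule.mul_mem_mul ⟨w, rfl⟩ (ih b hb)
    | add a _ b _ ha hb =>
      rw [map_add]
      exact Submodule.add_mem _ ha hb

theorem interiorProd_eq_zero_of_mem_exteriorPower_zero {V : Type*} [NormedAddCommGroup V]
    [InnerProductSpace ℝ V] (v : V) (x : ExteriorAlgebra ℝ V)
    (hx : x ∈ (⋀[ℝ]^0 V : Submodule ℝ (ExteriorAlgebra ℝ V))) : interiorProd v x = 0 := by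
  rw [ExteriorAlgebra.exteriorPower, pow_zero] at hx
  obtain ⟨r, rfl⟩ := Submodule.mem_one.mp hx
  exact CliffordAlgebra.contractLeft_algebraMap (0 : QuadraticForm ℝ V) (innerₗ V v) r

theorem epsilonMul_mem_exteriorPower {V : Type*} [NormedAddCommGroup V] [InnerProductSpace ℝ V]
    (v : V) (m : ℕ) (x : ExteriorAlgebra ℝ V)
    (hx : x ∈ (⋀[ℝ]^m V : Submodule ℝ (ExteriorAlgebra ℝ V))) :
    epsilonMul v x ∈ (⋀[ℝ]^(m + 1) V : Submodule ℝ (ExteriorAlgebra ℝ V)) := by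
  rw [ExteriorAlgebra.exteriorPower, pow_succ']
  exact Submodule.mul_mem_mul ⟨v, rfl⟩ hx

/-- Rescaling by `T`, acting on `Λ^m V` as `l^{-m}`, intertwines Clifford multiplication
`ε_v - ι_v` with `l⁻¹ (ε_v - l² ι_v)`. -/
theorem smul_rescaling_epsilonMul_sub_interiorProd {V : Type*} [NormedAddCommGroup V]
    [InnerProductSpace ℝ V] {l : ℝ} (hl : l ≠ 0) (T : Module.End ℝ (ExteriorAlgebra ℝ V))
    (hT : ∀ m : ℕ, ∀ x ∈ (⋀[ℝ]^m V : Submodule ℝ (ExteriorAlgebra ℝ V)),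
      T x = l ^ (-(m : ℤ)) • x) (v : V) (x : ExteriorAlgebra ℝ V) :
    l • T ((epsilonMul v - interiorProd v) x)
      = (epsilonMul v - l ^ 2 • interiorProd v) (T x) := by
  induction x using DirectSum.Decomposition.inductionOn
    (fun m : ℕ => (⋀[ℝ]^m V : Submodule ℝ (ExteriorAlgebra ℝ V))) with
  | zero => simp
  | add a b ha hb => simp only [map_add, smul_add, ha, hb]
  | @homogeneous m x =>
    have hε := hT _ _ (epsilonMul_mem_exteriorPower v m x x.2)
    have hpow : l * l ^ (-((m + 1 : ℕ) : ℤ)) = l ^ (-(m : ℤ)) := by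
      rw [← zpow_one_add₀ hl]
      congr 1
      push_cast
      ring
    have hι : l • T (interiorProd v x) = (l ^ 2 * l ^ (-(m : ℤ))) • interiorProd v x := by
      cases m with
      | zero => simp [interiorProd_eq_zero_of_mem_exteriorPower_zero v x x.2]
      | succ m =>
        rw [hT _ _ (interiorProd_mem_exteriorPower v m x x.2), smul_smul]
        congr 1
        rw [← zpow_natCast l 2, ← zpow_add₀ hl, ← zpow_one_add₀ hl]
        congr 1
        push_cast
        ring
    rw [hT _ _ x.2, LinearMap.sub_apply, map_sub, smul_sub, hι, hε, smul_smul, hpow]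
    simp only [LinearMap.sub_apply, LinearMap.smul_apply, map_smul, smul_sub, smul_smul]
    rw [mul_comm (l ^ 2)]

/-- Conjugation by a linear equivalence, with one scalar per factor, distributes over a product
of endomorphisms. -/
theorem pow_smul_conj_list_prod {R M ι : Type*} [CommRing R] [AddCommGroup M] [Module R M]
    (T : M ≃ₗ[R] M) (r : R) (A B : ι → Module.End R M)
    (h : ∀ j x, r • T (A j x) = B j (T x)) (L : List ι) :
    r ^ L.length • (T.toLinearMap ∘ₗ (L.map A).prod ∘ₗ T.symm.toLinearMap) = (L.map B).prod := by
  induction L with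
  | nil => ext x; simp
  | cons j L ih =>
    ext x
    rw [List.map_cons, List.map_cons, List.prod_cons, List.prod_cons, ← ih]
    simp [pow_succ, mul_smul, h]

/-- A linear functional of a product of factors `A j - l² B j` is continuous in `l`. -/
theorem continuous_apply_list_prod_sub_sq_smul {R ι : Type*} [Ring R] [Algebra ℝ R]
    (A B : ι → R) (L : List ι) (φ : R →ₗ[ℝ] ℝ) :
    Continuous fun l : ℝ => φ (L.map fun j => A j - l ^ 2 • B j).prod := by
  induction L generalizing φ with
  | nil => simpa using continuous_const
  | cons j L ih =>
    have hA := ih (φ ∘ₗ LinearMap.mulLeft ℝ (A j))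
    have hB := ih (φ ∘ₗ LinearMap.mulLeft ℝ (B j))
    simp only [LinearMap.comp_apply, LinearMap.mulLeft_apply] at hA hB
    simp only [List.map_cons, List.prod_cons, sub_mul, smul_mul_assoc, map_sub, map_smul,
      smul_eq_mul]
    exact hA.sub ((continuous_pow 2).mul hB)

/-- As `λ → 0⁺`, the rescaled Clifford multiplications
`λ^k U_λ^♯ (c(e_{i₁}) ∘ ⋯ ∘ c(e_{i_k}))` converge in `End(ΛV)` (finite-dimensional, so
convergence is tested against all linear functionals) to the exterior multiplication
`ε_{e_{i₁}} ∘ ⋯ ∘ ε_{e_{i_k}}`. -/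
theorem getzler_limit_clifford_to_exterior
    (V : Type*) [NormedAddCommGroup V] [InnerProductSpace ℝ V] [FiniteDimensional ℝ V]
    (n : ℕ) (e : OrthonormalBasis (Fin n) ℝ V)
    (Q : QuadraticForm ℝ V) (hQ : ∀ v : V, Q v = -‖v‖ ^ 2)
    (c : CliffordAlgebra Q →ₐ[ℝ] Module.End ℝ (ExteriorAlgebra ℝ V))
    (hc : ∀ v : V, c (CliffordAlgebra.ι Q v) = epsilonMul v - interiorProd v)
    (U : ℝ → (ExteriorAlgebra ℝ V ≃ₗ[ℝ] ExteriorAlgebra ℝ V))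
    (hU : ∀ l : ℝ, 0 < l → ∀ m : ℕ, ∀ x ∈ (⋀[ℝ]^m V : Submodule ℝ (ExteriorAlgebra ℝ V)),
      U l x = l ^ (-(m : ℤ)) • x)
    (k : ℕ) (i : Fin k → Fin n) (hi : StrictMono i) :
    ∀ φ : Module.End ℝ (ExteriorAlgebra ℝ V) →ₗ[ℝ] ℝ,
      Tendsto
        (fun l : ℝ => φ (l ^ k •
          ((U l).toLinearMap ∘ₗ
            (List.ofFn fun j : Fin k => c (CliffordAlgebra.ι Q (e (i j)))).prod ∘ₗ
            (U l).symm.toLinearMap)))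
        (𝓝[>] (0 : ℝ))
        (𝓝 (φ (LinearMap.mulLeft ℝ
          (List.ofFn fun j : Fin k => ExteriorAlgebra.ι ℝ (e (i j))).prod))) := by
  intro φ
  set L := List.ofFn i with hL
  have hlen : L.length = k := List.length_ofFn
  have hc' : (List.ofFn fun j : Fin k => c (CliffordAlgebra.ι Q (e (i j)))) =
      L.map fun j => epsilonMul (e j) - interiorProd (e j) := by
    simp only [hL, List.map_ofFn, hc]
    rfl
  have hlim : LinearMap.mulLeft ℝ (List.ofFn fun j : Fin k => ExteriorAlgebra.ι ℝ (e (i j))).prod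
      = (L.map fun j => epsilonMul (e j) - (0 : ℝ) ^ 2 • interiorProd (e j)).prod := by
    have hmap := map_list_prod (Algebra.lmul ℝ (ExteriorAlgebra ℝ V))
      (List.ofFn fun j : Fin k => ExteriorAlgebra.ι ℝ (e (i j)))
    rw [List.map_ofFn] at hmap
    simp only [ne_eq, OfNat.ofNat_ne_zero, not_false_eq_true, zero_pow, zero_smul, sub_zero]
    rw [hL, List.map_ofFn]
    exact hmap
  rw [hlim, hc']
  refine ((continuous_apply_list_prod_sub_sq_smul (fun j => epsilonMul (e j))
    (fun j => interiorProd (e j)) L φ).tendsto 0 |>.mono_left nhdsWithin_le_nhds).congr' ?_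
  filter_upwards [self_mem_nhdsWithin] with l hl
  have hl : 0 < l := hl
  have h := pow_smul_conj_list_prod (U l) l _ _
    (fun j x => smul_rescaling_epsilonMul_sub_interiorProd hl.ne' (U l).toLinearMap (hU l hl) (e j) x)
    L
  rw [hlen] at h
  rw [h]
end

section
/- Let h : ℝⁿ → ℝ be a smooth function and q a nonnegative integer such that all partial derivatives ∂^β h(0) vanish for every multi-index β with |β| < q. Let γ be a multi-index and θ a real number with θ < max(|γ|, q). Then λ^{−θ} ∂^γ(h ∘ f_λ)(x) = λ^{|γ| − θ} (∂^γ h)(λx) converges to 0 as λ → 0⁺, uniformly for x in any compact subset of ℝⁿ. -/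
open Filter Topology

/-- The partial derivative `∂_i` of a function on `ℝⁿ`. -/
noncomputable def pder {n : ℕ} {E : Type*} [NormedAddCommGroup E] [NormedSpace ℝ E]
    (i : Fin n) (f : (Fin n → ℝ) → E) : (Fin n → ℝ) → E :=
  fun x => fderiv ℝ f x (Pi.single i 1)

/-- The iterated partial derivative `∂^γ = ∂₀^{γ₀} ∘ ⋯ ∘ ∂_{n−1}^{γ_{n−1}}` attached to a
multi-index `γ`. -/
noncomputable def mpder {n : ℕ} {E : Type*} [NormedAddCommGroup E] [NormedSpace ℝ E]
    (γ : Fin n → ℕ) : ((Fin n → ℝ) → E) → ((Fin n → ℝ) → E) :=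
  (List.ofFn fun i : Fin n => (pder i)^[γ i]).foldr (· ∘ ·) id

/-- The composition of the partial derivatives along a list of coordinates. -/
noncomputable def listPder {n : ℕ} (L : List (Fin n)) (f : (Fin n → ℝ) → ℝ) : (Fin n → ℝ) → ℝ :=
  L.foldr pder f

/-- The list in which the coordinate `i` occurs `γ i` times. -/
def multiIndexList {n : ℕ} (γ : Fin n → ℕ) : List (Fin n) :=
  (List.finRange n).flatMap fun i => List.replicate (γ i) i

theorem mpder_eq_listPder {n : ℕ} (γ : Fin n → ℕ) (f : (Fin n → ℝ) → ℝ) :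
    mpder γ f = listPder (multiIndexList γ) f := by
  have foldr_replicate (i : Fin n) (k : ℕ) (g : (Fin n → ℝ) → ℝ) :
      (List.replicate k i).foldr pder g = (pder i)^[k] g := by
    induction k with
    | zero => rfl
    | succ k ih => rw [List.replicate_succ, List.foldr_cons, ih, Function.iterate_succ_apply']
  rw [mpder, listPder, multiIndexList, List.ofFn_eq_map]
  induction List.finRange n with
  | nil => rfl
  | cons i l ih =>
    rw [List.map_cons, List.foldr_cons, Function.comp_apply, ih, List.flatMap_cons,
      List.foldr_append, foldr_replicate]

theorem count_multiIndexList {n : ℕ} (γ : Fin n → ℕ) (i : Fin n) :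
    (multiIndexList γ).count i = γ i := by
  rw [multiIndexList, List.count_flatMap, ← List.ofFn_eq_map, List.sum_ofFn]
  simp [List.count_replicate]

theorem length_multiIndexList {n : ℕ} (γ : Fin n → ℕ) :
    (multiIndexList γ).length = ∑ i, γ i := by
  rw [multiIndexList, List.length_flatMap, ← List.ofFn_eq_map, List.sum_ofFn]
  simp

theorem perm_multiIndexList_count {n : ℕ} (L : List (Fin n)) :
    L.Perm (multiIndexList fun i => L.count i) :=
  List.perm_iff_count.2 fun i => (count_multiIndexList (fun j => L.count j) i).symm

theorem ContDiff.pder {n : ℕ} {f : (Fin n → ℝ) → ℝ} (hf : ContDiff ℝ (⊤ : ℕ∞) f) (i : Fin n) :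
    ContDiff ℝ (⊤ : ℕ∞) (pder i f) :=
  (hf.fderiv_right (m := (⊤ : ℕ∞)) (by simp)).clm_apply contDiff_const

theorem ContDiff.listPder {n : ℕ} {f : (Fin n → ℝ) → ℝ} (hf : ContDiff ℝ (⊤ : ℕ∞) f)
    (L : List (Fin n)) : ContDiff ℝ (⊤ : ℕ∞) (listPder L f) := by
  induction L with
  | nil => exact hf
  | cons i L ih => exact ih.pder i

theorem pder_comm {n : ℕ} {f : (Fin n → ℝ) → ℝ} (hf : ContDiff ℝ (⊤ : ℕ∞) f) (i j : Fin n) :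
    pder i (pder j f) = pder j (pder i f) := by
  have hd : Differentiable ℝ (fderiv ℝ f) :=
    (hf.fderiv_right (m := (⊤ : ℕ∞)) (by simp)).differentiable (by simp)
  have second_pder (i j : Fin n) (x : Fin n → ℝ) :
      pder i (pder j f) x = fderiv ℝ (fderiv ℝ f) x (Pi.single i 1) (Pi.single j 1) := by
    change fderiv ℝ (fun y => fderiv ℝ f y (Pi.single j 1)) x _ = _
    rw [fderiv_clm_apply (hd x) (differentiableAt_const _)]
    simp
  funext x
  rw [second_pder, second_pder]
  exact (hf.contDiffAt.isSymmSndFDerivAt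
    (by simpa using WithTop.coe_le_coe.2 (le_top : (2 : ℕ∞) ≤ ⊤))) _ _

theorem listPder_perm {n : ℕ} {f : (Fin n → ℝ) → ℝ} (hf : ContDiff ℝ (⊤ : ℕ∞) f)
    {L M : List (Fin n)} (hLM : L.Perm M) : listPder L f = listPder M f := by
  induction hLM with
  | nil => rfl
  | cons i _ ih => exact congrArg (pder i) ih
  | swap i j L => exact pder_comm (hf.listPder L) j i
  | trans _ _ ih₁ ih₂ => exact ih₁.trans ih₂

theorem listPder_comp_smul {n : ℕ} {f : (Fin n → ℝ) → ℝ} (hf : ContDiff ℝ (⊤ : ℕ∞) f)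
    (L : List (Fin n)) (c : ℝ) :
    listPder L (fun y => f (c • y)) = fun x => c ^ L.length * listPder L f (c • x) := by
  induction L with
  | nil => simp [listPder]
  | cons i L ih =>
    change pder i (listPder L _) = fun x => _ * pder i (listPder L f) (c • x)
    funext x
    have hd : Differentiable ℝ fun x => listPder L f (c • x) :=
      ((hf.listPder L).comp (contDiff_const_smul c)).differentiable (by simp)
    rw [ih, pder, fderiv_const_mul (hd x), fderiv_comp_smul]
    simp [pder, pow_succ, mul_assoc]

theorem norm_le_sum_norm_apply_single {n : ℕ} (T : (Fin n → ℝ) →L[ℝ] ℝ) :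
    ‖T‖ ≤ ∑ i, ‖T (Pi.single i 1)‖ := by
  refine T.opNorm_le_bound (by positivity) fun v => ?_
  calc ‖T v‖ = ‖∑ i, v i * T (Pi.single i 1)‖ := by
        conv_lhs => rw [pi_eq_sum_univ' v, map_sum]
        simp
    _ ≤ ∑ i, ‖v i * T (Pi.single i 1)‖ := norm_sum_le _ _
    _ ≤ ∑ i, ‖T (Pi.single i 1)‖ * ‖v‖ := by
        gcongr with i
        rw [norm_mul, mul_comm]
        gcongr
        exact norm_le_pi_norm v i
    _ = _ := (Finset.sum_mul _ _ _).symm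

/-- A smooth function whose derivatives of order `< m` vanish at `0` is `O(‖x‖ ^ m)` on balls. -/
theorem exists_norm_le_mul_norm_pow {n : ℕ} (R : ℝ) (m : ℕ) {g : (Fin n → ℝ) → ℝ}
    (hg : ContDiff ℝ (⊤ : ℕ∞) g)
    (hvan : ∀ L : List (Fin n), L.length < m → listPder L g 0 = 0) :
    ∃ C, 0 ≤ C ∧ ∀ x, ‖x‖ ≤ R → ‖g x‖ ≤ C * ‖x‖ ^ m := by
  induction m generalizing g with
  | zero =>
    obtain ⟨C, hC⟩ := (isCompact_closedBall (0 : Fin n → ℝ) R).exists_bound_of_continuousOn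
      hg.continuous.continuousOn
    refine ⟨max C 0, le_max_right _ _, fun x hx => ?_⟩
    simpa using Or.inl (hC x (by simpa using hx))
  | succ m ih =>
    have hpder (i : Fin n) : ∃ C, 0 ≤ C ∧ ∀ x, ‖x‖ ≤ R → ‖pder i g x‖ ≤ C * ‖x‖ ^ m := by
      refine ih (hg.pder i) fun L hL => ?_
      have := hvan (L ++ [i]) (by simpa using hL)
      simpa [listPder] using this
    choose C hC0 hC using hpder
    refine ⟨∑ i, C i, Finset.sum_nonneg fun i _ => hC0 i, fun x hx => ?_⟩
    have hfderiv : ∀ y ∈ Metric.closedBall (0 : Fin n → ℝ) ‖x‖,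
        ‖fderiv ℝ g y‖ ≤ (∑ i, C i) * ‖x‖ ^ m := by
      intro y hy
      rw [mem_closedBall_zero_iff] at hy
      refine (norm_le_sum_norm_apply_single _).trans ?_
      rw [Finset.sum_mul]
      refine Finset.sum_le_sum fun i _ => (hC i y (hy.trans hx)).trans ?_
      have := hC0 i
      gcongr
    have hmvt := (convex_closedBall (0 : Fin n → ℝ) ‖x‖).norm_image_sub_le_of_norm_fderiv_le
      (fun y _ => hg.differentiable (by simp) y) hfderiv
      (Metric.mem_closedBall_self (norm_nonneg x)) (mem_closedBall_zero_iff.2 le_rfl)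
    have hg0 : g 0 = 0 := hvan [] (by simp)
    simpa [hg0, pow_succ, mul_assoc] using hmvt

/-- If all partial derivatives of `h` of order `< q` vanish at `0` and `θ < max(|γ|, q)`, then
`λ^{−θ} ∂^γ(h ∘ f_λ)(x) = λ^{|γ|−θ} (∂^γ h)(λx)` tends to `0` as `λ → 0⁺`, uniformly on
compact subsets of `ℝⁿ`. -/
theorem rescaled_deriv_tendsto_zero {n : ℕ} (h : (Fin n → ℝ) → ℝ) (hsm : ContDiff ℝ (⊤ : ℕ∞) h)
    (q : ℕ) (hq : ∀ β : Fin n → ℕ, (∑ i, β i) < q → mpder β h 0 = 0)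
    (γ : Fin n → ℕ) (θ : ℝ) (hθ : θ < ((max (∑ i, γ i) q : ℕ) : ℝ)) :
    (∀ l : ℝ, 0 < l → ∀ x : Fin n → ℝ,
      l ^ (-θ) * mpder γ (fun y => h (l • y)) x
        = l ^ (((∑ i, γ i : ℕ) : ℝ) - θ) * mpder γ h (l • x)) ∧
    (∀ K : Set (Fin n → ℝ), IsCompact K →
      TendstoUniformlyOn (fun (l : ℝ) (x : Fin n → ℝ) => l ^ (-θ) * mpder γ (fun y => h (l • y)) x)
        (fun _ => 0) (𝓝[>] (0 : ℝ)) K) := by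
  have scaling : ∀ l : ℝ, 0 < l → ∀ x : Fin n → ℝ,
      l ^ (-θ) * mpder γ (fun y => h (l • y)) x
        = l ^ (((∑ i, γ i : ℕ) : ℝ) - θ) * mpder γ h (l • x) := by
    intro l hl x
    rw [mpder_eq_listPder, mpder_eq_listPder, listPder_comp_smul hsm, length_multiIndexList,
      sub_eq_neg_add, Real.rpow_add hl, Real.rpow_natCast, mul_assoc]
  refine ⟨scaling, fun K hK => ?_⟩
  obtain ⟨R, hR0, hR⟩ := hK.isBounded.exists_pos_norm_le
  obtain ⟨C, hC0, hC⟩ := exists_norm_le_mul_norm_pow R (q - ∑ i, γ i)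
    (hsm.listPder (multiIndexList γ)) fun L hL => by
      have hcount := hq (fun i => (L ++ multiIndexList γ).count i) (by
        rw [← length_multiIndexList, ← (perm_multiIndexList_count _).length_eq,
          List.length_append, length_multiIndexList]
        omega)
      rwa [mpder_eq_listPder, ← listPder_perm hsm (perm_multiIndexList_count _), listPder,
        List.foldr_append] at hcount
  set m := q - ∑ i, γ i with hm
  have hexp : (((∑ i, γ i : ℕ) : ℝ) - θ) + m = ((max (∑ i, γ i) q : ℕ) : ℝ) - θ := by
    rw [show max (∑ i, γ i) q = (∑ i, γ i) + m by omega, Nat.cast_add]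
    ring
  have hlim : Tendsto (fun l : ℝ => l ^ (((max (∑ i, γ i) q : ℕ) : ℝ) - θ) * (C * R ^ m))
      (𝓝[>] 0) (𝓝 0) := by
    have hpos := sub_pos.2 hθ
    have hcont := (Real.continuousAt_rpow_const 0 _ (Or.inr hpos.le)).tendsto.mul_const (C * R ^ m)
    rw [Real.zero_rpow hpos.ne', zero_mul] at hcont
    exact hcont.mono_left nhdsWithin_le_nhds
  rw [Metric.tendstoUniformlyOn_iff]
  intro ε hε
  filter_upwards [hlim.eventually_lt_const hε, Ioo_mem_nhdsGT one_pos] with l hlε hl x hx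
  have hl0 : 0 < l := hl.1
  rw [scaling l hl0, dist_zero_left, norm_mul, Real.norm_of_nonneg (by positivity)]
  refine lt_of_le_of_lt ?_ hlε
  have hnorm : ‖l • x‖ = l * ‖x‖ := by rw [norm_smul, Real.norm_of_nonneg hl0.le]
  have hxR := hR x hx
  have hbound := hC (l • x) (by rw [hnorm]; nlinarith [norm_nonneg x, hl.2])
  rw [hnorm, mul_pow] at hbound
  rw [← hexp, Real.rpow_add hl0, Real.rpow_natCast, mpder_eq_listPder, mul_assoc]
  gcongr
  calc _ ≤ C * (l ^ m * ‖x‖ ^ m) := hbound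
    _ ≤ C * (l ^ m * R ^ m) := by gcongr
    _ = _ := by ring
end
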